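/- Let h : [0,T) → 𝒳 be continuously differentiable, where 𝒳 is a complex Banach space, and let 0 < α < 1. Then the function u = D_+^α h is continuous on (0,T), Bochner integrable near 0, and satisfies the Abel integral equation (J^α u)(t) = h(t) for all 0 < t < T; moreover, u is the unique such function: if w : (0,T) → 𝒳 is continuous, Bochner integrable near 0, and satisfies (J^α w)(t) = h(t) for all 0 < t < T, then w(t) = (D_+^α h)(t) for all 0 < t < T. -/

import Mathlib

open MeasureTheory Set Filter

/-- Riemann–Liouville fractional integral of order `β` with lower terminal `τ`:
`(_τJ^β g)(t) = (1/Γ(β)) ∫_τ^t (t−s)^{β−1} g(s) ds`; for `β = 0` it is the identity. -/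
noncomputable def fracInt {X : Type*} [NormedAddCommGroup X] [NormedSpace ℝ X]
    (τ β : ℝ) (g : ℝ → X) (t : ℝ) : X :=
  if β = 0 then g t
  else (1 / Real.Gamma β) • ∫ s in τ..t, (t - s) ^ (β - 1) • g s

/-- Riemann–Liouville fractional derivative of order `α` with lower terminal `τ`:
`(_τD_+^α g)(t) = (d/dt)(_τJ^{1−α} g)(t)`. -/
noncomputable def fracDerivRL {X : Type*} [NormedAddCommGroup X] [NormedSpace ℝ X]
    (τ α : ℝ) (g : ℝ → X) (t : ℝ) : X :=
  deriv (fracInt τ (1 - α) g) t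

/-- Caputo–Djrbashian fractional derivative of order `α` with lower terminal `τ`:
`(_τD_*^α g)(t) = (_τJ^{1−α} g′)(t)`. -/
noncomputable def fracDerivCaputo {X : Type*} [NormedAddCommGroup X] [NormedSpace ℝ X]
    (τ α : ℝ) (g : ℝ → X) (t : ℝ) : X :=
  fracInt τ (1 - α) (deriv g) t

/-- `J^β` (lower terminal `0`) for arbitrary real order: the fractional integral for `β ≥ 0`
and the Riemann–Liouville derivative `D_+^{−β}` for `β < 0`. -/
noncomputable def Jgen {X : Type*} [NormedAddCommGroup X] [NormedSpace ℝ X]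
    (β : ℝ) (g : ℝ → X) (t : ℝ) : X :=
  if 0 ≤ β then fracInt 0 β g t else fracDerivRL 0 (-β) g t

/-- `h ∈ C^λ([0,T],X)`: the Hölder condition of order `λ` on `[0,T]`. -/
def InHolderSpace {X : Type*} [NormedAddCommGroup X] (lam T : ℝ) (h : ℝ → X) : Prop :=
  ∃ C : ℝ, ∀ s ∈ Set.Icc (0:ℝ) T, ∀ t ∈ Set.Icc (0:ℝ) T, ‖h t - h s‖ ≤ C * |t - s| ^ lam

/-- The Hölder norm `‖h‖_{C^λ} = sup_t ‖h(t)‖ + sup_{s≠t} ‖h(t)−h(s)‖/|t−s|^λ` on `[0,T]`. -/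
noncomputable def holderNorm {X : Type*} [NormedAddCommGroup X] (lam T : ℝ) (h : ℝ → X) : ℝ :=
  (⨆ t : Set.Icc (0:ℝ) T, ‖h t.1‖) +
  ⨆ p : Set.Icc (0:ℝ) T × Set.Icc (0:ℝ) T,
    if p.1.1 = p.2.1 then 0 else ‖h p.1.1 - h p.2.1‖ / |p.1.1 - p.2.1| ^ lam

/-- Absolute continuity on `[0,T]`: `g(t) = g(0) + ∫_0^t φ(s) ds` for some Bochner-integrable φ. -/
def AbsContOn {X : Type*} [NormedAddCommGroup X] [NormedSpace ℝ X] [CompleteSpace X]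
    (T : ℝ) (g : ℝ → X) : Prop :=
  ∃ φ : ℝ → X, IntervalIntegrable φ MeasureTheory.volume 0 T ∧
    ∀ t ∈ Set.Icc (0:ℝ) T, g t = g 0 + ∫ s in (0:ℝ)..t, φ s

/-- The Volterra system associated with orders `α`, matrix `a` and data `h`:
`g_k(t) + Σ_{j≠k} a_{kj} (J^{α_{jj}−α_{kj}} g_j)(t) = Σ_{j≠k} a_{kj} (J^{α_{jj}−α_{kj}} h_j)(t)`
for `t ∈ (0,T]`, together with the initial conditions `g_j(0) = h_j(0)`. -/
def VolterraSol {X : Type*} [NormedAddCommGroup X] [NormedSpace ℝ X]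
    {m : ℕ} (T : ℝ) (α a : Fin m → Fin m → ℝ) (h g : Fin m → ℝ → X) : Prop :=
  (∀ k, ∀ t ∈ Set.Ioc (0:ℝ) T,
      g k t + ∑ j ∈ Finset.univ.erase k, a k j • Jgen (α j j - α k j) (g j) t
        = ∑ j ∈ Finset.univ.erase k, a k j • Jgen (α j j - α k j) (h j) t) ∧
  (∀ j, g j 0 = h j 0)

/-- The Abel kernels of complementary orders `a` and `b = 1 - a` convolve to a constant. -/
theorem integral_abel_kernel {a b r t : ℝ} (ha : 0 < a) (hb : 0 < b) (hab : a + b = 1)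
    (hrt : r < t) :
    ∫ s in r..t, (t - s) ^ (a - 1) * (s - r) ^ (b - 1) = Real.Gamma a * Real.Gamma b := by
  have h1 : ∫ s in r..t, (t - s) ^ (a - 1) * (s - r) ^ (b - 1)
      = ∫ x in (0:ℝ)..(t - r), x ^ (b - 1) * ((t - r) - x) ^ (a - 1) := by
    have := intervalIntegral.integral_comp_add_right (a := 0) (b := t - r)
      (fun s : ℝ => (t - s) ^ (a - 1) * (s - r) ^ (b - 1)) r
    rw [zero_add, sub_add_cancel] at this
    rw [← this]
    refine intervalIntegral.integral_congr fun x _ => ?_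
    simp only [add_sub_cancel_right]
    rw [mul_comm]
    congr 2
    ring
  have h2 := Complex.betaIntegral_scaled b a (sub_pos.2 hrt)
  have hba : (b : ℂ) + a = 1 := by rw [← Complex.ofReal_add, add_comm, hab, Complex.ofReal_one]
  rw [Complex.betaIntegral_eq_Gamma_mul_div _ _ (by simpa) (by simpa), hba, sub_self,
    Complex.cpow_zero, Complex.Gamma_one, one_mul, div_one, Complex.Gamma_ofReal,
    Complex.Gamma_ofReal] at h2
  rw [h1, mul_comm (Real.Gamma a)]
  apply Complex.ofReal_injective
  rw [Complex.ofReal_mul, ← h2, ← intervalIntegral.integral_ofReal]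
  refine intervalIntegral.integral_congr fun x hx => ?_
  rw [uIcc_of_le (sub_pos.2 hrt).le] at hx
  have e1 := Complex.ofReal_cpow hx.1 (b - 1)
  have e2 := Complex.ofReal_cpow (sub_nonneg.2 hx.2) (a - 1)
  push_cast at e1 e2 ⊢
  rw [e1, e2]

theorem intervalIntegrable_abel_kernel {a b r t : ℝ} (ha : 0 < a) (hb : 0 < b) (hab : a + b = 1)
    (hrt : r < t) :
    IntervalIntegrable (fun s : ℝ => (t - s) ^ (a - 1) * (s - r) ^ (b - 1)) volume r t := by
  apply intervalIntegral.intervalIntegrable_of_integral_ne_zero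
  rw [integral_abel_kernel ha hb hab hrt]
  exact (mul_pos (Real.Gamma_pos_of_pos ha) (Real.Gamma_pos_of_pos hb)).ne'

theorem intervalIntegrable_const_sub_rpow {a t : ℝ} (ha : 0 < a) :
    IntervalIntegrable (fun s : ℝ => (t - s) ^ (a - 1)) volume 0 t := by
  have := (intervalIntegral.intervalIntegrable_rpow' (a := 0) (b := t) (r := a - 1)
    (by linarith)).comp_sub_left t
  simpa using this.symm

section FracInt

variable {X : Type*} [NormedAddCommGroup X] [NormedSpace ℝ X]

/-- Dirichlet's formula for the iterated Abel integrals of complementary orders. -/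
theorem integral_abel_kernel_iterated [CompleteSpace X] {a b t : ℝ} (ha : 0 < a) (hb : 0 < b)
    (hab : a + b = 1) (ht : 0 < t) {g : ℝ → X} (hg : IntervalIntegrable g volume 0 t) :
    ∫ s in (0:ℝ)..t, (t - s) ^ (a - 1) • ∫ r in (0:ℝ)..s, (s - r) ^ (b - 1) • g r
      = (Real.Gamma a * Real.Gamma b) • ∫ r in (0:ℝ)..t, g r := by
  set μ := volume.restrict (Ioo (0:ℝ) t) with hμ
  have hgμ : Integrable g μ := (intervalIntegrable_iff_integrableOn_Ioo_of_le ht.le).1 hg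
  let K : ℝ → ℝ → ℝ := fun s r => if r < s then (t - s) ^ (a - 1) * (s - r) ^ (b - 1) else 0
  have hKmeas : Measurable (fun p : ℝ × ℝ => K p.1 p.2) := by
    refine Measurable.ite (measurableSet_lt measurable_snd measurable_fst) ?_ measurable_const
    fun_prop
  have hKnonneg : ∀ s < t, ∀ r, 0 ≤ K s r := by
    intro s hs r
    simp only [K]
    split_ifs with h
    · exact mul_nonneg (Real.rpow_nonneg (by linarith) _) (Real.rpow_nonneg (by linarith) _)
    · exact le_rfl
  have hK_eq : ∀ r, (fun s => K s r)
      = (Ioi r).indicator (fun s => (t - s) ^ (a - 1) * (s - r) ^ (b - 1)) := by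
    intro r; ext s; simp [K, indicator]
  have hinter : ∀ r ∈ Ioo 0 t, Ioo 0 t ∩ Ioi r = Ioo r t := by
    intro r hr; ext x; simp only [mem_inter_iff, mem_Ioo, mem_Ioi] at *
    grind
  have hK_int : ∀ r ∈ Ioo 0 t, Integrable (fun s => K s r) μ := by
    intro r hr
    rw [hK_eq, integrable_indicator_iff measurableSet_Ioi, IntegrableOn, hμ,
      Measure.restrict_restrict measurableSet_Ioi, inter_comm, hinter r hr]
    exact (intervalIntegrable_iff_integrableOn_Ioo_of_le hr.2.le).1
      (intervalIntegrable_abel_kernel ha hb hab hr.2)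
  have hK_val : ∀ r ∈ Ioo 0 t, ∫ s, K s r ∂μ = Real.Gamma a * Real.Gamma b := by
    intro r hr
    rw [hK_eq, hμ, setIntegral_indicator measurableSet_Ioi, hinter r hr,
      ← integral_Ioc_eq_integral_Ioo, ← intervalIntegral.integral_of_le hr.2.le]
    exact integral_abel_kernel ha hb hab hr.2
  have hF : Integrable (Function.uncurry fun s r => K s r • g r) (μ.prod μ) := by
    have hmeas : AEStronglyMeasurable (Function.uncurry fun s r => K s r • g r) (μ.prod μ) :=
      hKmeas.aestronglyMeasurable.smul hgμ.aestronglyMeasurable.comp_snd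
    refine (integrable_prod_iff' hmeas).2 ⟨?_, ?_⟩
    · filter_upwards [ae_restrict_mem measurableSet_Ioo] with r hr
      exact (hK_int r hr).smul_const (g r)
    · refine (hgμ.norm.const_mul (Real.Gamma a * Real.Gamma b)).congr ?_
      filter_upwards [ae_restrict_mem measurableSet_Ioo] with r hr
      rw [← hK_val r hr, ← integral_mul_const]
      refine integral_congr_ae ?_
      filter_upwards [ae_restrict_mem measurableSet_Ioo] with s hs
      simp only [Function.uncurry, norm_smul, Real.norm_of_nonneg (hKnonneg s hs.2 r)]
  have hswap := integral_integral_swap hF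
  have hR : ∫ r, ∫ s, K s r • g r ∂μ ∂μ = (Real.Gamma a * Real.Gamma b) • ∫ r, g r ∂μ := by
    rw [← integral_smul]
    refine integral_congr_ae ?_
    filter_upwards [ae_restrict_mem measurableSet_Ioo] with r hr
    rw [integral_smul_const, hK_val r hr]
  have hL : ∫ s, ∫ r, K s r • g r ∂μ ∂μ
      = ∫ s, ((t - s) ^ (a - 1) • ∫ r in (0:ℝ)..s, (s - r) ^ (b - 1) • g r) ∂μ := by
    refine integral_congr_ae ?_
    filter_upwards [ae_restrict_mem measurableSet_Ioo] with s hs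
    have e : (fun r => K s r • g r)
        = (Iio s).indicator (fun r => (t - s) ^ (a - 1) • (s - r) ^ (b - 1) • g r) := by
      ext r; by_cases h : r < s <;> simp [K, h, mul_smul]
    have e' : Ioo 0 t ∩ Iio s = Ioo 0 s := by
      ext x; simp only [mem_inter_iff, mem_Ioo, mem_Iio] at *; grind
    rw [e, hμ, setIntegral_indicator measurableSet_Iio, e', integral_smul,
      intervalIntegral.integral_of_le hs.1.le, integral_Ioc_eq_integral_Ioo]
  rw [intervalIntegral.integral_of_le ht.le, intervalIntegral.integral_of_le ht.le,
    integral_Ioc_eq_integral_Ioo, integral_Ioc_eq_integral_Ioo, ← hL, hswap, hR]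

theorem fracInt_of_pos {τ β : ℝ} (hβ : 0 < β) (g : ℝ → X) (t : ℝ) :
    fracInt τ β g t = (1 / Real.Gamma β) • ∫ s in τ..t, (t - s) ^ (β - 1) • g s :=
  if_neg hβ.ne'

/-- Fractional integrals of complementary orders compose to the ordinary integral. -/
theorem fracInt_fracInt_of_add_eq_one [CompleteSpace X] {a b t : ℝ} (ha : 0 < a) (hb : 0 < b)
    (hab : a + b = 1) (ht : 0 < t) {g : ℝ → X} (hg : IntervalIntegrable g volume 0 t) :
    fracInt 0 a (fracInt 0 b g) t = ∫ s in (0:ℝ)..t, g s := by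
  have hΓa := (Real.Gamma_pos_of_pos ha).ne'
  have hΓb := (Real.Gamma_pos_of_pos hb).ne'
  simp_rw [fracInt_of_pos ha, fracInt_of_pos hb, smul_comm _ (1 / Real.Gamma b),
    intervalIntegral.integral_smul, integral_abel_kernel_iterated ha hb hab ht hg, smul_smul]
  rw [show 1 / Real.Gamma a * (1 / Real.Gamma b * (Real.Gamma a * Real.Gamma b)) = 1 by
    field_simp, one_smul]

theorem fracInt_congr {T β t : ℝ} (hβ : 0 < β) {f g : ℝ → X} (hfg : EqOn f g (Ioo 0 T))
    (ht : t ∈ Ioo 0 T) : fracInt 0 β f t = fracInt 0 β g t := by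
  rw [fracInt_of_pos hβ, fracInt_of_pos hβ]
  congr 1
  refine intervalIntegral.integral_congr_uIoo fun s hs => ?_
  rw [uIoo_of_le ht.1.le] at hs
  simp only [hfg ⟨hs.1, hs.2.trans ht.2⟩]

theorem fracInt_eq_rpow_smul {b t : ℝ} (hb : 0 < b) (ht : 0 ≤ t) (g : ℝ → X) :
    fracInt 0 b g t
      = (1 / Real.Gamma b * t ^ b) • ∫ x in (0:ℝ)..1, (1 - x) ^ (b - 1) • g (t * x) := by
  rw [fracInt_of_pos hb, mul_smul]
  congr 1
  rcases ht.eq_or_lt with rfl | ht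
  · simp [Real.zero_rpow hb.ne']
  have e := intervalIntegral.smul_integral_comp_mul_left (a := 0) (b := 1)
    (fun s => (t - s) ^ (b - 1) • g s) t
  rw [mul_zero, mul_one] at e
  rw [← e, ← intervalIntegral.integral_smul, ← intervalIntegral.integral_smul]
  refine intervalIntegral.integral_congr fun x hx => ?_
  rw [uIcc_of_le zero_le_one] at hx
  simp only [smul_smul]
  rw [show t - t * x = t * (1 - x) by ring, Real.mul_rpow ht.le (by linarith [hx.2]), ← mul_assoc]
  congr 2
  nth_rewrite 1 [← Real.rpow_one t]
  rw [← Real.rpow_add ht]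
  congr 1
  ring

theorem continuousOn_fracInt {T b : ℝ} (hb : 0 < b) {g : ℝ → X}
    (hg : ContinuousOn g (Ico 0 T)) : ContinuousOn (fracInt 0 b g) (Ico 0 T) := by
  have key : ContinuousOn (fun t : ℝ => ∫ x in (0:ℝ)..1, (1 - x) ^ (b - 1) • g (t * x))
      (Ico 0 T) := by
    intro t₀ ht₀
    obtain ⟨T₁, h₁, h₂⟩ := exists_between ht₀.2
    obtain ⟨M, hM⟩ := isCompact_Icc.exists_bound_of_continuousOn
      (hg.mono (Icc_subset_Ico_right h₂))
    have hev : ∀ᶠ t in nhdsWithin t₀ (Ico 0 T), t ∈ Icc 0 T₁ := by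
      filter_upwards [self_mem_nhdsWithin, nhdsWithin_le_nhds (Iio_mem_nhds h₁)] with t ht ht'
      exact ⟨ht.1, ht'.le⟩
    have hmem : ∀ t ∈ Icc 0 T₁, ∀ x ∈ uIoc (0:ℝ) 1, t * x ∈ Icc 0 T₁ := by
      intro t ht x hx
      rw [uIoc_of_le zero_le_one] at hx
      exact ⟨mul_nonneg ht.1 hx.1.le, (mul_le_of_le_one_right ht.1 hx.2).trans ht.2⟩
    refine intervalIntegral.continuousWithinAt_of_dominated_interval
      (bound := fun x => (1 - x) ^ (b - 1) * M) ?_ ?_ ?_ ?_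
    · filter_upwards [hev] with t ht
      refine AEStronglyMeasurable.smul
        (Measurable.aestronglyMeasurable (by fun_prop)) ?_
      refine ContinuousOn.aestronglyMeasurable ?_ measurableSet_uIoc
      exact hg.comp (by fun_prop) fun x hx => Icc_subset_Ico_right h₂ (hmem t ht x hx)
    · filter_upwards [hev] with t ht
      refine .of_forall fun x hx => ?_
      have hx1 : x ≤ 1 := by
        rw [uIoc_of_le zero_le_one] at hx
        exact hx.2
      rw [norm_smul, Real.norm_of_nonneg (Real.rpow_nonneg (by linarith) _)]
      exact mul_le_mul_of_nonneg_left (hM _ (hmem t ht x hx)) (Real.rpow_nonneg (by linarith) _)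
    · exact (intervalIntegrable_const_sub_rpow hb).mul_const M
    · refine .of_forall fun x hx => ContinuousWithinAt.const_smul ?_ _
      refine ContinuousWithinAt.comp (t := Ico 0 T) (f := fun t => t * x)
        (hg _ (Icc_subset_Ico_right h₂ (hmem _ ⟨ht₀.1, h₁.le⟩ x hx))) (by fun_prop) ?_
      intro t ht
      rw [uIoc_of_le zero_le_one] at hx
      exact ⟨mul_nonneg ht.1 hx.1.le, (mul_le_of_le_one_right ht.1 hx.2).trans_lt ht.2⟩
  refine ContinuousOn.congr (ContinuousOn.smul (f := fun t : ℝ => 1 / Real.Gamma b * t ^ b) ?_ key)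
    fun t ht => fracInt_eq_rpow_smul hb ht.1 g
  exact (continuous_const.mul (Real.continuous_rpow_const hb.le)).continuousOn

/-- A solution of Abel's equation `J^α w = h` is the Riemann–Liouville derivative of `h`. -/
theorem eq_fracDerivRL_of_fracInt_eq [CompleteSpace X] {T α : ℝ} (hα : α ∈ Ioo (0:ℝ) 1)
    {h w : ℝ → X} (hw : ContinuousOn w (Ioo 0 T))
    (hwi : ∀ t ∈ Ioo (0:ℝ) T, IntervalIntegrable w volume 0 t)
    (hwh : EqOn (fracInt 0 α w) h (Ioo 0 T)) : EqOn w (fracDerivRL 0 α h) (Ioo 0 T) := by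
  intro t ht
  have hev : fracInt 0 (1 - α) h =ᶠ[nhds t] fun t => ∫ s in (0:ℝ)..t, w s := by
    filter_upwards [Ioo_mem_nhds ht.1 ht.2] with s hs
    rw [← fracInt_congr (sub_pos.2 hα.2) hwh hs]
    exact fracInt_fracInt_of_add_eq_one (sub_pos.2 hα.2) hα.1 (by ring) hs.1 (hwi s hs)
  rw [fracDerivRL, hev.deriv_eq]
  exact (intervalIntegral.integral_hasDerivAt_right (hwi t ht)
    (hw.stronglyMeasurableAtFilter isOpen_Ioo t ht)
    (hw.continuousAt (Ioo_mem_nhds ht.1 ht.2))).deriv.symm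

/-- Abel's equation `J^α v = h` has an explicit solution, in terms of `h 0` and `h'`. -/
theorem exists_fracInt_eq [CompleteSpace X] {T α : ℝ} (hα : α ∈ Ioo (0:ℝ) 1)
    {h : ℝ → X} (hh : ContDiffOn ℝ 1 h (Ico 0 T)) :
    ∃ v : ℝ → X, ContinuousOn v (Ioo 0 T) ∧
      (∀ t ∈ Ioo (0:ℝ) T, IntervalIntegrable v volume 0 t) ∧
      EqOn (fracInt 0 α v) h (Ioo 0 T) := by
  have hα' : 0 < 1 - α := sub_pos.2 hα.2
  have hΓa := (Real.Gamma_pos_of_pos hα.1).ne'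
  have hΓb := (Real.Gamma_pos_of_pos hα').ne'
  set g := derivWithin h (Ico 0 T)
  have hg : ContinuousOn g (Ico 0 T) :=
    hh.continuousOn_derivWithin (uniqueDiffOn_Ico 0 T) le_rfl
  have hJ := continuousOn_fracInt hα' hg
  have hsub : ∀ t ∈ Ioo 0 T, uIcc 0 t ⊆ Ico 0 T := fun t ht => by
    rw [uIcc_of_le ht.1.le]
    exact Icc_subset_Ico_right ht.2
  have hftc : ∀ t ∈ Ioo 0 T, ∫ s in (0:ℝ)..t, g s = h t - h 0 := by
    intro t ht
    have hst : Icc 0 t ⊆ Ico 0 T := Icc_subset_Ico_right ht.2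
    refine intervalIntegral.integral_eq_sub_of_hasDerivAt_of_le ht.1.le
      (hh.continuousOn.mono hst) (fun x hx => ?_) (hg.mono (hsub t ht)).intervalIntegrable
    have hx' : x ∈ Ico 0 T := ⟨hx.1.le, hx.2.trans ht.2⟩
    exact (hh.differentiableOn one_ne_zero x hx').hasDerivWithinAt.hasDerivAt
      (Ico_mem_nhds hx.1 (hx.2.trans ht.2))
  have hpow : ∀ t, IntervalIntegrable
      (fun s : ℝ => (1 / Real.Gamma (1 - α) * s ^ (1 - α - 1)) • h 0) volume 0 t := fun t =>
    ((intervalIntegral.intervalIntegrable_rpow' (by linarith [hα.2])).const_mul _).smul_continuousOn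
      continuousOn_const
  refine ⟨fun t => (1 / Real.Gamma (1 - α) * t ^ (1 - α - 1)) • h 0 + fracInt 0 (1 - α) g t,
    ?_, ?_, ?_⟩
  · refine ContinuousOn.add ?_ (hJ.mono Ioo_subset_Ico_self)
    refine ContinuousOn.smul (continuousOn_const.mul ?_) continuousOn_const
    exact fun x hx => (Real.continuousAt_rpow_const x _ (Or.inl hx.1.ne')).continuousWithinAt
  · exact fun t ht => (hpow t).add (hJ.mono (hsub t ht)).intervalIntegrable
  · intro t ht
    have hcomp := fracInt_fracInt_of_add_eq_one hα.1 hα' (by ring) ht.1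
      (hg.mono (hsub t ht)).intervalIntegrable
    rw [fracInt_of_pos hα.1, hftc t ht] at hcomp
    have hker := intervalIntegrable_abel_kernel hα.1 hα' (by ring) ht.1
    have hval := integral_abel_kernel hα.1 hα' (by ring) ht.1
    simp only [sub_zero] at hker hval
    have e : ∀ s : ℝ, (t - s) ^ (α - 1) • (1 / Real.Gamma (1 - α) * s ^ (1 - α - 1)) • h 0
        = ((t - s) ^ (α - 1) * s ^ (1 - α - 1)) • (1 / Real.Gamma (1 - α)) • h 0 := by
      intro s
      simp only [smul_smul]
      congr 1
      ring
    rw [fracInt_of_pos hα.1]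
    simp only [smul_add, e]
    rw [intervalIntegral.integral_add (hker.smul_continuousOn continuousOn_const)
      ((intervalIntegrable_const_sub_rpow hα.1).smul_continuousOn (hJ.mono (hsub t ht))),
      smul_add, hcomp, intervalIntegral.integral_smul_const, hval, smul_smul, smul_smul,
      show 1 / Real.Gamma α * (Real.Gamma α * Real.Gamma (1 - α)) * (1 / Real.Gamma (1 - α)) = 1 by
        field_simp, one_smul, add_sub_cancel]

end FracInt

/-- **Abel's integral equation of the first kind (Lemma 3.1).**
For `h` continuously differentiable on `[0,T)` and `0 < α < 1`, the function
`u = D_+^α h` is continuous on `(0,T)`, Bochner integrable near `0`, solves the Abel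
equation `(J^α u)(t) = h(t)` on `(0,T)`, and is the unique such function. -/
theorem abel_integral_equation
    {X : Type*} [NormedAddCommGroup X] [NormedSpace ℂ X] [CompleteSpace X]
    (T : ℝ) (hT : 0 < T) (α : ℝ) (hα : α ∈ Set.Ioo (0:ℝ) 1)
    (h : ℝ → X) (hh : ContDiffOn ℝ 1 h (Set.Ico 0 T)) :
    (ContinuousOn (fracDerivRL 0 α h) (Set.Ioo 0 T) ∧
      (∀ t ∈ Set.Ioo (0:ℝ) T,
        IntervalIntegrable (fracDerivRL 0 α h) MeasureTheory.volume 0 t) ∧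
      ∀ t ∈ Set.Ioo (0:ℝ) T, fracInt 0 α (fracDerivRL 0 α h) t = h t) ∧
    ∀ w : ℝ → X, ContinuousOn w (Set.Ioo 0 T) →
      (∀ t ∈ Set.Ioo (0:ℝ) T, IntervalIntegrable w MeasureTheory.volume 0 t) →
      (∀ t ∈ Set.Ioo (0:ℝ) T, fracInt 0 α w t = h t) →
      ∀ t ∈ Set.Ioo (0:ℝ) T, w t = fracDerivRL 0 α h t := by
  obtain ⟨v, hv, hvi, hvh⟩ := exists_fracInt_eq hα hh
  have huv := eq_fracDerivRL_of_fracInt_eq hα hv hvi hvh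
  refine ⟨⟨hv.congr fun t ht => (huv ht).symm, fun t ht => ?_, fun t ht => ?_⟩,
    fun w hw hwi hwh => eq_fracDerivRL_of_fracInt_eq hα hw hwi hwh⟩
  · refine (hvi t ht).congr fun s hs => ?_
    rw [uIoc_of_le ht.1.le] at hs
    exact huv ⟨hs.1, hs.2.trans_lt ht.2⟩
  · rw [← fracInt_congr hα.1 huv ht, hvh ht]
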